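/- In any execution starting from an arbitrary initial configuration, a configuration containing no bad nodes is reached after a finite number of execution steps (i.e., the first phase of the execution is completed in a finite number of steps). -/

import Mathlib

open scoped Classical

/-- A pre-configuration: a finite node set `V` with a partial parent map
(`none` means the node has no parent) and an integer height assignment. -/
structure PreConfig (V : Type*) where
  parent : V → Option V
  height : V → ℤ

namespace PreConfig

variable {V : Type*} [Fintype V] [LinearOrder V]

/-- The children of `u` are the nodes whose parent is `u`. -/
noncomputable def children (C : PreConfig V) (u : V) : Finset V :=
  Finset.univ.filter (fun v => C.parent v = some u)

/-- A leaf is a node with no children. -/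
def IsLeaf (C : PreConfig V) (u : V) : Prop := C.children u = ∅

/-- Maximum height value among the children of `u` (junk value `0` for a leaf). -/
noncomputable def maxH (C : PreConfig V) (u : V) : ℤ :=
  if h : (C.children u).Nonempty then (C.children u).sup' h C.height else 0

/-- Minimum height value among the children of `u` (junk value `0` for a leaf). -/
noncomputable def minH (C : PreConfig V) (u : V) : ℤ :=
  if h : (C.children u).Nonempty then (C.children u).inf' h C.height else 0

/-- A child of `u` of maximum height value; ties broken by a fixed rule
(smallest ID). Junk value `u` for a leaf. -/
noncomputable def maxChild (C : PreConfig V) (u : V) : V :=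
  if h : ((C.children u).filter fun v => C.height v = C.maxH u).Nonempty
  then ((C.children u).filter fun v => C.height v = C.maxH u).min' h else u

/-- A child of `u` of minimum height value; ties broken by a fixed rule
(smallest ID). Junk value `u` for a leaf. -/
noncomputable def minChild (C : PreConfig V) (u : V) : V :=
  if h : ((C.children u).filter fun v => C.height v = C.minH u).Nonempty
  then ((C.children u).filter fun v => C.height v = C.minH u).min' h else u

/-- `stable(u)`: `h(u) = 0` if `u` is a leaf, and `h(u) = 1 + max_{w child of u} h(w)` otherwise. -/
def Stable (C : PreConfig V) (u : V) : Prop :=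
  (C.IsLeaf u ∧ C.height u = 0) ∨ (¬ C.IsLeaf u ∧ C.height u = 1 + C.maxH u)

/-- `balanced(u)`: `|h(z) − h(z')| ≤ α` for all children `z, z'` of `u`. -/
def Balanced (α : ℤ) (C : PreConfig V) (u : V) : Prop :=
  ∀ z ∈ C.children u, ∀ z' ∈ C.children u, |C.height z - C.height z'| ≤ α

/-- `u` is enabled for a height update iff `¬stable(u)`. -/
def UpdateEnabled (C : PreConfig V) (u : V) : Prop := ¬ C.Stable u

/-- `u` is enabled for a swap iff `stable(u) ∧ stable(max(u)) ∧ ¬balanced(u)`. -/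
def SwapEnabled (α : ℤ) (C : PreConfig V) (u : V) : Prop :=
  C.Stable u ∧ C.Stable (C.maxChild u) ∧ ¬ Balanced α C u

/-- `u` is enabled iff it is enabled for a height update or for a swap. -/
def Enabled (α : ℤ) (C : PreConfig V) (u : V) : Prop :=
  C.UpdateEnabled u ∨ SwapEnabled α C u

/-- The value written by a height update: `0` for a leaf, `1 + max_{w child of u} h(w)` otherwise. -/
noncomputable def newHeight (C : PreConfig V) (u : V) : ℤ :=
  if C.IsLeaf u then 0 else 1 + C.maxH u

/-- A bad node: an internal node `u` with `h(u) ≤ max_{v child of u} h(v)`,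
or a leaf `u` with `h(u) < 0`. -/
def Bad (C : PreConfig V) (u : V) : Prop :=
  (¬ C.IsLeaf u ∧ C.height u ≤ C.maxH u) ∨ (C.IsLeaf u ∧ C.height u < 0)

/-- `v` reaches `a` by iterating the parent map. -/
def Reaches (C : PreConfig V) (v a : V) : Prop :=
  Relation.ReflTransGen (fun x y => C.parent x = some y) v a

/-- The underlying graph is a rooted tree with root `r`: `r` has no parent,
every other node has a (unique) parent, and every node reaches `r` by
iterating the parent map. -/
def IsTree (C : PreConfig V) (r : V) : Prop :=
  C.parent r = none ∧ (∀ v, C.parent v = none → v = r) ∧ ∀ v, C.Reaches v r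

/-- The subtree `S_u` of `u`: the set of descendants of `u` (including `u`). -/
def subtree (C : PreConfig V) (u : V) : Set V := {v | C.Reaches v u}

/-- The actual height `h*(u)` of `u`: the length of a longest directed path
going downward from `u` (such a maximal path necessarily ends at a leaf of `S_u`). -/
noncomputable def hstar (C : PreConfig V) (u : V) : ℕ :=
  sSup {n : ℕ | ∃ f : ℕ → V, f 0 = u ∧ ∀ i < n, C.parent (f (i + 1)) = some (f i)}

/-- An execution step `C →_A C'`: a nonempty set `A` of nodes enabled in `C` is
activated simultaneously; each `u ∈ A` enabled for a height update sets its height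
to `newHeight`; each `u ∈ A` enabled for a swap replaces the edges `(u, min(u))` and
`(max(u), max(max(u)))` by `(u, max(max(u)))` and `(max(u), min(u))` (all guards and
functions evaluated in `C`); everything else is unchanged. -/
structure Step (α : ℤ) (C C' : PreConfig V) (A : Finset V) : Prop where
  nonempty : A.Nonempty
  all_enabled : ∀ u ∈ A, Enabled α C u
  height_update : ∀ u ∈ A, C.UpdateEnabled u → C'.height u = C.newHeight u
  height_keep : ∀ u, ¬ (u ∈ A ∧ C.UpdateEnabled u) → C'.height u = C.height u
  swap_out : ∀ u ∈ A, SwapEnabled α C u → C'.parent (C.minChild u) = some (C.maxChild u)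
  swap_in : ∀ u ∈ A, SwapEnabled α C u → C'.parent (C.maxChild (C.maxChild u)) = some u
  parent_keep : ∀ v, (∀ u ∈ A, SwapEnabled α C u →
      v ≠ C.minChild u ∧ v ≠ C.maxChild (C.maxChild u)) → C'.parent v = C.parent v

end PreConfig

namespace PreConfig

variable {V : Type*} [Fintype V] [LinearOrder V]

/-! ### Children, leaves and extremal children -/

theorem mem_children {C : PreConfig V} {u v : V} : v ∈ C.children u ↔ C.parent v = some u := by
  simp [children]

theorem isLeaf_iff {C : PreConfig V} {u : V} : C.IsLeaf u ↔ ∀ v, C.parent v ≠ some u := by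
  simp [IsLeaf, Finset.eq_empty_iff_forall_notMem, mem_children]

theorem not_isLeaf_of_parent {C : PreConfig V} {u v : V} (h : C.parent v = some u) :
    ¬ C.IsLeaf u := fun hl => isLeaf_iff.1 hl v h

theorem nonempty_children {C : PreConfig V} {u : V} (h : ¬ C.IsLeaf u) :
    (C.children u).Nonempty := Finset.nonempty_iff_ne_empty.2 h

theorem height_le_maxH {C : PreConfig V} {u v : V} (h : C.parent v = some u) :
    C.height v ≤ C.maxH u := by
  have hv := mem_children.2 h
  rw [maxH, dif_pos ⟨v, hv⟩]
  exact Finset.le_sup' C.height hv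

theorem minH_le_height {C : PreConfig V} {u v : V} (h : C.parent v = some u) :
    C.minH u ≤ C.height v := by
  have hv := mem_children.2 h
  rw [minH, dif_pos ⟨v, hv⟩]
  exact Finset.inf'_le C.height hv

theorem maxChild_spec {C : PreConfig V} {u : V} (h : ¬ C.IsLeaf u) :
    C.parent (C.maxChild u) = some u ∧ C.height (C.maxChild u) = C.maxH u := by
  have hne := nonempty_children h
  have hf : ((C.children u).filter fun v => C.height v = C.maxH u).Nonempty := by
    obtain ⟨v, hv, hvm⟩ := Finset.exists_mem_eq_sup' hne C.height
    exact ⟨v, Finset.mem_filter.2 ⟨hv, by rw [maxH, dif_pos hne, hvm]⟩⟩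
  have hm := Finset.mem_filter.1 (Finset.min'_mem _ hf)
  rw [maxChild, dif_pos hf]
  exact ⟨mem_children.1 hm.1, hm.2⟩

theorem minChild_spec {C : PreConfig V} {u : V} (h : ¬ C.IsLeaf u) :
    C.parent (C.minChild u) = some u ∧ C.height (C.minChild u) = C.minH u := by
  have hne := nonempty_children h
  have hf : ((C.children u).filter fun v => C.height v = C.minH u).Nonempty := by
    obtain ⟨v, hv, hvm⟩ := Finset.exists_mem_eq_inf' hne C.height
    exact ⟨v, Finset.mem_filter.2 ⟨hv, by rw [minH, dif_pos hne, hvm]⟩⟩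
  have hm := Finset.mem_filter.1 (Finset.min'_mem _ hf)
  rw [minChild, dif_pos hf]
  exact ⟨mem_children.1 hm.1, hm.2⟩

theorem maxChild_of_isLeaf {C : PreConfig V} {u : V} (h : C.IsLeaf u) : C.maxChild u = u := by
  rw [maxChild, dif_neg]
  rw [IsLeaf] at h
  simp [h]

/-! ### Stable, bad and swap-enabled nodes -/

theorem Stable.not_bad {C : PreConfig V} {u : V} (h : C.Stable u) : ¬ C.Bad u := by
  rcases h with ⟨hl, h⟩ | ⟨hl, h⟩ <;> rintro (⟨hl', h'⟩ | ⟨hl', h'⟩) <;> first | contradiction | omega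

theorem Bad.updateEnabled {C : PreConfig V} {u : V} (h : C.Bad u) : C.UpdateEnabled u :=
  fun hs => hs.not_bad h

theorem height_lt_of_not_bad {C : PreConfig V} {u v : V} (h : ¬ C.Bad u)
    (hv : C.parent v = some u) : C.height v < C.height u := by
  by_contra hlt
  exact h (Or.inl ⟨not_isLeaf_of_parent hv, (not_lt.1 hlt).trans (height_le_maxH hv)⟩)

theorem newHeight_lt_of_not_bad {C : PreConfig V} {u : V} (h : ¬ C.Bad u)
    (hu : C.UpdateEnabled u) : C.newHeight u < C.height u := by
  unfold UpdateEnabled Stable at hu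
  unfold Bad at h
  unfold newHeight
  split_ifs with hl
  · simp only [hl, true_and, not_true, false_and, or_false, false_or] at h hu
    omega
  · simp only [hl, true_and, not_false_eq_true, false_and, or_false, false_or] at h hu
    omega

theorem SwapEnabled.spec {α : ℤ} (hα : 1 ≤ α) {C : PreConfig V} {u : V}
    (h : SwapEnabled α C u) :
    C.parent (C.maxChild u) = some u ∧ C.parent (C.minChild u) = some u ∧
      C.height u = C.height (C.maxChild u) + 1 ∧
      C.height (C.minChild u) + 2 ≤ C.height (C.maxChild u) := by
  obtain ⟨hs, -, hb⟩ := h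
  simp only [Balanced, not_forall, mem_children] at hb
  obtain ⟨z, hz, z', hz', hzz⟩ := hb
  have hl := not_isLeaf_of_parent hz
  obtain ⟨h1, h2⟩ := maxChild_spec hl
  obtain ⟨h3, h4⟩ := minChild_spec hl
  refine ⟨h1, h3, ?_, ?_⟩
  · rcases hs with ⟨hl', -⟩ | ⟨-, hs⟩
    · contradiction
    · omega
  · have := height_le_maxH hz
    have := height_le_maxH hz'
    have := minH_le_height hz
    have := minH_le_height hz'
    rw [abs_le] at hzz
    omega

theorem SwapEnabled.grandchild_spec {α : ℤ} {C : PreConfig V} {u : V}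
    (h : SwapEnabled α C u) (hl : ¬ C.IsLeaf (C.maxChild u)) :
    C.parent (C.maxChild (C.maxChild u)) = some (C.maxChild u) ∧
      C.height (C.maxChild u) = C.height (C.maxChild (C.maxChild u)) + 1 := by
  obtain ⟨h1, h2⟩ := maxChild_spec hl
  refine ⟨h1, ?_⟩
  rcases h.2.1 with ⟨hl', -⟩ | ⟨-, hs⟩
  · contradiction
  · omega

/-! ### A single execution step -/

namespace Step

variable {α : ℤ} {C C' : PreConfig V} {A : Finset V}

theorem parent_cases (hα : 1 ≤ α) (hS : Step α C C' A) (v : V) :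
    C'.parent v = C.parent v ∨
      (∃ u ∈ A, SwapEnabled α C u ∧ v = C.minChild u ∧ C'.parent v = some (C.maxChild u)) ∨
      ∃ u ∈ A, SwapEnabled α C u ∧ ¬ C.IsLeaf (C.maxChild u) ∧
        v = C.maxChild (C.maxChild u) ∧ C'.parent v = some u := by
  by_cases h : ∃ u ∈ A, SwapEnabled α C u ∧ (v = C.minChild u ∨ v = C.maxChild (C.maxChild u))
  · obtain ⟨u, huA, hu, rfl | rfl⟩ := h
    · exact Or.inr (Or.inl ⟨u, huA, hu, rfl, hS.swap_out u huA hu⟩)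
    · by_cases hl : C.IsLeaf (C.maxChild u)
      · left
        rw [hS.swap_in u huA hu, maxChild_of_isLeaf hl, (hu.spec hα).1]
      · exact Or.inr (Or.inr ⟨u, huA, hu, hl, rfl, hS.swap_in u huA hu⟩)
  · left
    refine hS.parent_keep v fun u huA hu => ?_
    constructor <;> rintro rfl <;> exact h ⟨u, huA, hu, by simp⟩

theorem parent_eq_none (hα : 1 ≤ α) (hS : Step α C C' A) {v : V} (hv : C.parent v = none) :
    C'.parent v = none := by
  rcases hS.parent_cases hα v with h | ⟨u, -, hu, rfl, -⟩ | ⟨u, -, hu, hl, rfl, -⟩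
  · rw [h, hv]
  · simp [(hu.spec hα).2.1] at hv
  · simp [(hu.grandchild_spec hl).1] at hv

theorem not_isLeaf (hα : 1 ≤ α) (hS : Step α C C' A) {v : V} (hv : ¬ C.IsLeaf v) :
    ¬ C'.IsLeaf v := by
  by_cases h1 : v ∈ A ∧ SwapEnabled α C v
  · exact not_isLeaf_of_parent (hS.swap_in v h1.1 h1.2)
  by_cases h2 : ∃ u ∈ A, SwapEnabled α C u ∧ v = C.maxChild u
  · obtain ⟨u, huA, hu, rfl⟩ := h2
    exact not_isLeaf_of_parent (hS.swap_out u huA hu)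
  obtain ⟨c, hc⟩ := nonempty_children hv
  rw [mem_children] at hc
  rcases hS.parent_cases hα c with h | ⟨u, huA, hu, rfl, -⟩ | ⟨u, huA, hu, hl, rfl, -⟩
  · exact not_isLeaf_of_parent (h.trans hc)
  · obtain rfl : u = v := by simpa [(hu.spec hα).2.1] using hc
    exact absurd ⟨huA, hu⟩ h1
  · have : C.maxChild u = v := by simpa [(hu.grandchild_spec hl).1] using hc
    exact absurd ⟨u, huA, hu, this.symm⟩ h2

theorem wellFounded_parent (hα : 1 ≤ α) (hS : Step α C C' A)
    (hW : WellFounded fun p v => C.parent v = some p) :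
    WellFounded fun p v => C'.parent v = some p := by
  suffices H : ∀ v, Acc (fun p v => C'.parent v = some p) v ∧
      ∀ c, C.parent c = some v → Acc (fun p v => C'.parent v = some p) c from
    ⟨fun v => (H v).1⟩
  intro v
  induction v using hW.induction with
  | _ v ih =>
  have hv : Acc (fun p v => C'.parent v = some p) v := by
    rcases hp : C.parent v with _ | p
    · exact ⟨v, fun y hy => by simp [hS.parent_eq_none hα hp] at hy⟩
    · exact (ih p hp).2 v hp
  have of_parent : ∀ c p, C'.parent c = some p → Acc (fun p v => C'.parent v = some p) p →
      Acc (fun p v => C'.parent v = some p) c := by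
    intro c p hc hp
    refine ⟨c, fun y hy => ?_⟩
    obtain rfl : p = y := by simpa [hc] using hy
    exact hp
  have not_min : ∀ c, C.parent c = some v →
      (∀ u ∈ A, SwapEnabled α C u → c ≠ C.minChild u) →
      Acc (fun p v => C'.parent v = some p) c := by
    intro c hc hmin
    rcases hS.parent_cases hα c with h | ⟨u, huA, hu, h, -⟩ | ⟨u, huA, hu, hl, rfl, h⟩
    · exact of_parent c v (h.trans hc) hv
    · exact absurd h (hmin u huA hu)
    · have : C.maxChild u = v := by simpa [(hu.grandchild_spec hl).1] using hc
      exact of_parent _ u h (ih u (this ▸ (hu.spec hα).1)).1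
  refine ⟨hv, fun c hc => ?_⟩
  by_cases hmin : ∃ u ∈ A, SwapEnabled α C u ∧ c = C.minChild u
  · obtain ⟨u, huA, hu, rfl⟩ := hmin
    obtain rfl : u = v := by simpa [(hu.spec hα).2.1] using hc
    refine of_parent _ _ (hS.swap_out u huA hu) (not_min _ (hu.spec hα).1 ?_)
    intro u' hu'A hu' heq
    have h1 := (hu.spec hα).1
    rw [heq, (hu'.spec hα).2.1] at h1
    obtain rfl : u' = u := by simpa using h1
    have := (hu.spec hα).2.2.2
    rw [← heq] at this
    omega
  · push Not at hmin
    exact not_min c hc hmin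

theorem height_le (hS : Step α C C' A) {v : V} (h : ¬ (v ∈ A ∧ C.Bad v)) :
    C'.height v ≤ C.height v := by
  by_cases hu : v ∈ A ∧ C.UpdateEnabled v
  · rw [hS.height_update v hu.1 hu.2]
    exact (newHeight_lt_of_not_bad (fun hb => h ⟨hu.1, hb⟩) hu.2).le
  · exact (hS.height_keep v hu).le

theorem le_height (hS : Step α C C' A) {L : ℤ} (hL : L ≤ 0) (h : ∀ v, L ≤ C.height v) (v : V) :
    L ≤ C'.height v := by
  by_cases hu : v ∈ A ∧ C.UpdateEnabled v
  · rw [hS.height_update v hu.1 hu.2, newHeight]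
    split_ifs with hl
    · exact hL
    · have := (maxChild_spec hl).2
      have := h (C.maxChild v)
      omega
  · rw [hS.height_keep v hu]
    exact h v

theorem bad_source (hα : 1 ≤ α) (hS : Step α C C' A) {v : V} (hv : C'.Bad v) :
    (C.Bad v ∧ v ∉ A) ∨ ∃ c, C'.parent c = some v ∧ C.Bad c ∧ c ∈ A := by
  by_contra! hcon
  obtain ⟨h1, h2⟩ := hcon
  have hle : ∀ c, C'.parent c = some v → C'.height c ≤ C.height c :=
    fun c hc => hS.height_le fun hb => h2 c hc hb.2 hb.1
  by_cases hu : v ∈ A ∧ C.UpdateEnabled v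
  · have hh := hS.height_update v hu.1 hu.2
    have hch : ∀ c, C'.parent c = some v → C.parent c = some v := by
      intro c hc
      rcases hS.parent_cases hα c with h | ⟨u, -, hu', rfl, h⟩ | ⟨u, -, hu', -, rfl, h⟩
      · rw [← h, hc]
      · obtain rfl : C.maxChild u = v := by simpa [hc] using h.symm
        exact absurd hu'.2.1 hu.2
      · obtain rfl : u = v := by simpa [hc] using h.symm
        exact absurd hu'.1 hu.2
    rcases hv with ⟨hl, hv⟩ | ⟨hl, hv⟩
    · obtain ⟨hc, hcm⟩ := maxChild_spec hl
      have := hle _ hc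
      have := height_le_maxH (hch _ hc)
      rw [newHeight, if_neg (not_isLeaf_of_parent (hch _ hc))] at hh
      omega
    · have hl' : C.IsLeaf v := by_contra fun hn => hS.not_isLeaf hα hn hl
      rw [newHeight, if_pos hl'] at hh
      omega
  · have hh := hS.height_keep v hu
    have hnb : ¬ C.Bad v := fun hb => hu ⟨h1 hb, hb.updateEnabled⟩
    rcases hv with ⟨hl, hv⟩ | ⟨hl, hv⟩
    · obtain ⟨hc, hcm⟩ := maxChild_spec hl
      have hcle := hle _ hc
      rcases hS.parent_cases hα (C'.maxChild v) with
        h | ⟨u, -, hu', hcu, h⟩ | ⟨u, -, hu', hlu, hcu, h⟩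
      · have := height_lt_of_not_bad hnb (h ▸ hc)
        omega
      · obtain rfl : C.maxChild u = v := by simpa [hc] using h.symm
        have := (hu'.spec hα).2.2.2
        rw [← hcu] at this
        omega
      · obtain rfl : u = v := by simpa [hc] using h.symm
        have h3 := (hu'.spec hα).2.2.1
        have h4 := (hu'.grandchild_spec hlu).2
        rw [← hcu] at h4
        omega
    · have hl' : C.IsLeaf v := by_contra fun hn => hS.not_isLeaf hα hn hl
      exact hnb (Or.inr ⟨hl', by omega⟩)

/-- Each bad node of `C'` is charged to a bad node of `C`: itself if it was bad and not activated,
otherwise one of its children that was bad and activated. -/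
theorem exists_charge (hα : 1 ≤ α) (hS : Step α C C' A) :
    ∃ f : V → V, Set.InjOn f {v | C'.Bad v} ∧ ∀ v, C'.Bad v → C.Bad (f v) ∧
      ((f v = v ∧ v ∉ A) ∨ (C'.parent (f v) = some v ∧ f v ∈ A ∧ ¬ (C.Bad v ∧ v ∉ A))) := by
  have key : ∀ v, ∃ w, C'.Bad v → C.Bad w ∧
      ((w = v ∧ v ∉ A) ∨ (C'.parent w = some v ∧ w ∈ A ∧ ¬ (C.Bad v ∧ v ∉ A))) := by
    intro v
    by_cases hv : C'.Bad v
    · by_cases h : C.Bad v ∧ v ∉ A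
      · exact ⟨v, fun _ => ⟨h.1, Or.inl ⟨rfl, h.2⟩⟩⟩
      · obtain ⟨c, hc1, hc2, hc3⟩ := (hS.bad_source hα hv).resolve_left h
        exact ⟨c, fun _ => ⟨hc2, Or.inr ⟨hc1, hc3, h⟩⟩⟩
    · exact ⟨v, fun h => absurd h hv⟩
  choose f hf using key
  refine ⟨f, ?_, hf⟩
  intro x hx y hy hxy
  rcases (hf x hx).2 with ⟨h1, h1'⟩ | ⟨h1, h1', -⟩ <;>
    rcases (hf y hy).2 with ⟨h2, h2'⟩ | ⟨h2, h2', -⟩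
  · rw [← h1, hxy, h2]
  · rw [← hxy, h1] at h2'
    contradiction
  · rw [hxy, h2] at h1'
    contradiction
  · rw [hxy, h2] at h1
    simpa using h1.symm

theorem ncard_bad_le (hα : 1 ≤ α) (hS : Step α C C' A) :
    {v | C'.Bad v}.ncard ≤ {v | C.Bad v}.ncard := by
  obtain ⟨f, hinj, hf⟩ := hS.exists_charge hα
  exact Set.ncard_le_ncard_of_injOn f (fun v hv => (hf v hv).1) hinj (Set.toFinite _)

theorem exists_charged_of_ncard_eq (hα : 1 ≤ α) (hS : Step α C C' A)
    (hcard : {v | C'.Bad v}.ncard = {v | C.Bad v}.ncard) {c : V} (hc : C.Bad c) :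
    (c ∉ A ∧ C'.Bad c) ∨
      (c ∈ A ∧ ∃ v, C'.parent c = some v ∧ C'.Bad v ∧ ¬ (C.Bad v ∧ v ∉ A)) := by
  obtain ⟨f, hinj, hf⟩ := hS.exists_charge hα
  obtain ⟨v, hv, rfl⟩ := Set.surj_on_of_inj_on_of_ncard_le (s := {v | C'.Bad v})
    (t := {v | C.Bad v}) (fun v _ => f v) (fun v hv => (hf v hv).1)
    (fun x y hx hy h => hinj hx hy h) hcard.ge (Set.toFinite _) c hc
  rcases (hf v hv).2 with ⟨h1, h1'⟩ | ⟨h1, h1', h2⟩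
  · left
    rw [h1]
    exact ⟨h1', hv⟩
  · exact Or.inr ⟨h1', v, h1, hv, h2⟩

end Step

/-! ### Eventual behaviour of executions -/

open Filter

theorem eventually_succ_eq_of_succ_le {f : ℕ → ℤ} {L : ℤ} (hL : ∀ n, L ≤ f n)
    (hf : ∀ᶠ n in atTop, f (n + 1) ≤ f n) : ∀ᶠ n in atTop, f (n + 1) = f n := by
  obtain ⟨N, hN⟩ := eventually_atTop.1 hf
  have hanti : Antitone fun k => (f (N + k) - L).toNat := by
    refine antitone_nat_of_succ_le fun k => ?_
    have := hN (N + k) (by omega)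
    rw [← add_assoc]
    omega
  obtain ⟨M, hM⟩ := WellFoundedGT.monotone_chain_condition
    (⟨fun k => OrderDual.toDual (f (N + k) - L).toNat, hanti⟩ : ℕ →o ℕᵒᵈ)
  have hM' : ∀ k, M ≤ k → f (N + M) = f (N + k) := by
    intro k hk
    have h : (f (N + M) - L).toNat = (f (N + k) - L).toNat := hM k hk
    have := hL (N + M)
    have := hL (N + k)
    omega
  filter_upwards [eventually_ge_atTop (N + M)] with n hn
  obtain ⟨k, rfl⟩ := Nat.exists_eq_add_of_le hn
  rw [add_assoc N M k, add_assoc N, ← hM' (M + k) (by omega), ← hM' (M + k + 1) (by omega)]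

theorem eventually_or_eventually_not {P : ℕ → Prop} (h : ∀ᶠ n in atTop, P n → P (n + 1)) :
    (∀ᶠ n in atTop, P n) ∨ ∀ᶠ n in atTop, ¬ P n := by
  obtain ⟨N, hN⟩ := eventually_atTop.1 h
  by_cases hP : ∃ n ≥ N, P n
  · obtain ⟨n, hn, hPn⟩ := hP
    refine Or.inl (eventually_atTop.2 ⟨n, fun k hk => ?_⟩)
    induction k, hk using Nat.le_induction with
    | base => exact hPn
    | succ k hk ih => exact hN k (by omega) ih
  · push Not at hP
    exact Or.inr (eventually_atTop.2 ⟨N, hP⟩)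

/-- A node is settled if it performs only finitely many height updates. -/
def Settled (Cs : ℕ → PreConfig V) (As : ℕ → Finset V) (v : V) : Prop :=
  ∀ᶠ n in atTop, ¬ (v ∈ As n ∧ (Cs n).UpdateEnabled v)

section Execution

variable {α : ℤ} {Cs : ℕ → PreConfig V} {As : ℕ → Finset V}

theorem exists_height_lower_bound (hstep : ∀ n, Step α (Cs n) (Cs (n + 1)) (As n)) :
    ∃ L, ∀ n v, L ≤ (Cs n).height v := by
  obtain ⟨L, hL⟩ := Finite.exists_ge (Cs 0).height
  refine ⟨min L 0, fun n => ?_⟩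
  induction n with
  | zero => exact fun v => (min_le_left _ _).trans (hL v)
  | succ n ih => exact (hstep n).le_height (min_le_right _ _) ih

theorem settled_of_eventually_not_bad (hstep : ∀ n, Step α (Cs n) (Cs (n + 1)) (As n)) {v : V}
    (hv : ∀ᶠ n in atTop, ¬ (v ∈ As n ∧ (Cs n).Bad v)) : Settled Cs As v := by
  obtain ⟨L, hL⟩ := exists_height_lower_bound hstep
  have hconst := eventually_succ_eq_of_succ_le (f := fun n => (Cs n).height v)
    (fun n => hL n v) (hv.mono fun n hn => (hstep n).height_le hn)
  filter_upwards [hv, hconst] with n hn heq hu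
  have := newHeight_lt_of_not_bad (fun hb => hn ⟨hu.1, hb⟩) hu.2
  have := (hstep n).height_update v hu.1 hu.2
  omega

theorem eventually_not_updated_of_settled (Cs : ℕ → PreConfig V) (As : ℕ → Finset V) :
    ∀ᶠ n in atTop, ∀ v, Settled Cs As v → ¬ (v ∈ As n ∧ (Cs n).UpdateEnabled v) := by
  refine eventually_all.2 fun v => ?_
  by_cases hv : Settled Cs As v
  · exact Eventually.mono hv fun n hn _ => hn
  · exact Eventually.of_forall fun n h => absurd h hv

theorem eventually_ncard_bad_eq (hα : 1 ≤ α)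
    (hstep : ∀ n, Step α (Cs n) (Cs (n + 1)) (As n)) :
    ∀ᶠ n in atTop, {v | (Cs (n + 1)).Bad v}.ncard = {v | (Cs n).Bad v}.ncard := by
  have h := eventually_succ_eq_of_succ_le (f := fun n => ({v | (Cs n).Bad v}.ncard : ℤ)) (L := 0)
    (fun n => by positivity)
    (Eventually.of_forall fun n => by exact_mod_cast (hstep n).ncard_bad_le hα)
  exact h.mono fun n hn => by exact_mod_cast hn

/-- Eventually a settled node never becomes bad. -/
theorem eventually_bad_of_bad_succ (hα : 1 ≤ α)
    (hstep : ∀ n, Step α (Cs n) (Cs (n + 1)) (As n)) :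
    ∀ᶠ n in atTop, ∀ v, Settled Cs As v → (Cs (n + 1)).Bad v → (Cs n).Bad v := by
  refine eventually_all.2 fun v => ?_
  by_cases hv : Settled Cs As v
  · have h : ∀ᶠ n in atTop, (Cs n).Bad v → (Cs (n + 1)).Bad v := by
      filter_upwards [hv, eventually_ncard_bad_eq hα hstep] with n hn hcard hb
      rcases (hstep n).exists_charged_of_ncard_eq hα hcard hb with h | h
      · exact h.2
      · exact absurd ⟨h.1, hb.updateEnabled⟩ hn
    rcases eventually_or_eventually_not h with h | h
    · exact h.mono fun n hn _ _ => hn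
    · exact ((tendsto_add_atTop_nat 1).eventually h).mono fun n hn _ hb => absurd hb hn
  · exact Eventually.of_forall fun n h => absurd h hv

/-- Eventually every bad node performing an update is a child of a node that is not settled. -/
theorem eventually_exists_parent_not_settled (hα : 1 ≤ α)
    (hstep : ∀ n, Step α (Cs n) (Cs (n + 1)) (As n)) :
    ∀ᶠ n in atTop, ∀ c ∈ As n, (Cs n).Bad c →
      ∃ p, (Cs (n + 1)).parent c = some p ∧ ¬ Settled Cs As p := by
  filter_upwards [eventually_ncard_bad_eq hα hstep, eventually_bad_of_bad_succ hα hstep,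
    eventually_not_updated_of_settled Cs As] with n hcard hbad hupd c hcA hc
  rcases (hstep n).exists_charged_of_ncard_eq hα hcard hc with h | ⟨-, p, hp, hpb, hpn⟩
  · exact absurd hcA h.1
  · refine ⟨p, hp, fun hs => ?_⟩
    have hb := hbad p hs hpb
    exact hpn ⟨hb, fun hA => hupd p hs ⟨hA, hb.updateEnabled⟩⟩

/-- Eventually a child of a settled node `u` of height at least `h(u) - 1` is settled. -/
theorem eventually_settled_of_height_le (hα : 1 ≤ α)
    (hstep : ∀ n, Step α (Cs n) (Cs (n + 1)) (As n)) :
    ∀ᶠ n in atTop, ∀ u c, Settled Cs As u → (Cs n).parent c = some u →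
      (Cs n).height u - 1 ≤ (Cs n).height c → Settled Cs As c := by
  refine eventually_all.2 fun u => eventually_all.2 fun c => ?_
  by_cases hu : Settled Cs As u
  swap
  · exact Eventually.of_forall fun n h => absurd h hu
  have hpar := eventually_exists_parent_not_settled hα hstep
  have h : ∀ᶠ n in atTop,
      ¬ ((Cs n).parent c = some u ∧ (Cs n).height u - 1 ≤ (Cs n).height c) →
      ¬ ((Cs (n + 1)).parent c = some u ∧
        (Cs (n + 1)).height u - 1 ≤ (Cs (n + 1)).height c) := by
    filter_upwards [hpar, hu] with n hn hun
    rw [not_imp_not, (hstep n).height_keep u hun]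
    rintro ⟨hp, hh⟩
    have hle : (Cs (n + 1)).height c ≤ (Cs n).height c := by
      refine (hstep n).height_le fun hb => ?_
      obtain ⟨p, hp', hps⟩ := hn c hb.1 hb.2
      obtain rfl : u = p := by simpa [hp] using hp'
      exact hps hu
    refine ⟨?_, hh.trans hle⟩
    rcases (hstep n).parent_cases hα c with h | ⟨x, -, hx, rfl, h⟩ | ⟨x, -, hx, hl, rfl, h⟩
    · rw [← h, hp]
    · obtain rfl : (Cs n).maxChild x = u := by simpa [hp] using h.symm
      have := (hx.spec hα).2.2.2
      omega
    · obtain rfl : x = u := by simpa [hp] using h.symm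
      have := (hx.spec hα).2.2.1
      have := (hx.grandchild_spec hl).2
      omega
  rcases eventually_or_eventually_not h with h | h
  · exact h.mono fun n hn _ hp hh => absurd ⟨hp, hh⟩ hn
  · have hc : Settled Cs As c := by
      refine settled_of_eventually_not_bad hstep ?_
      filter_upwards [hpar, (tendsto_add_atTop_nat 1).eventually h] with n hn hpn hb
      obtain ⟨p, hp', hps⟩ := hn c hb.1 hb.2
      obtain rfl : u = p := by simpa [(not_not.1 hpn).1] using hp'
      exact hps hu
    exact Eventually.of_forall fun _ _ _ _ => hc

/-- Eventually an unsettled child of a settled node remains the child of a settled node. -/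
theorem eventually_parent_settled_succ (hα : 1 ≤ α)
    (hstep : ∀ n, Step α (Cs n) (Cs (n + 1)) (As n)) :
    ∀ᶠ n in atTop, ∀ c, ¬ Settled Cs As c → (∃ u, (Cs n).parent c = some u ∧ Settled Cs As u) →
      ∃ u, (Cs (n + 1)).parent c = some u ∧ Settled Cs As u := by
  filter_upwards [eventually_settled_of_height_le hα hstep] with n hn c hc hcu
  obtain ⟨u, hcu, hu⟩ := hcu
  rcases (hstep n).parent_cases hα c with h | ⟨x, -, hx, rfl, h⟩ | ⟨x, -, hx, hl, rfl, h⟩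
  · exact ⟨u, h.trans hcu, hu⟩
  · obtain ⟨h1, h2, h3, -⟩ := hx.spec hα
    obtain rfl : x = u := by simpa [h2] using hcu
    exact ⟨_, h, hn x _ hu h1 (by omega)⟩
  · obtain ⟨h1, h2⟩ := hx.grandchild_spec hl
    obtain rfl : (Cs n).maxChild x = u := by simpa [h1] using hcu
    exact absurd (hn _ _ hu h1 (by omega)) hc

theorem settled_of_wellFounded (hα : 1 ≤ α)
    (hstep : ∀ n, Step α (Cs n) (Cs (n + 1)) (As n))
    (hW : WellFounded fun p v => (Cs 0).parent v = some p) (v : V) : Settled Cs As v := by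
  have hWn : ∀ n, WellFounded fun p v => (Cs n).parent v = some p := by
    intro n
    induction n with
    | zero => exact hW
    | succ n ih => exact (hstep n).wellFounded_parent hα ih
  have hpar := eventually_exists_parent_not_settled hα hstep
  obtain ⟨N, hN⟩ := eventually_atTop.1 (eventually_parent_settled_succ hα hstep)
  induction v using (hWn N).induction with
  | _ v ih =>
  by_contra hv
  refine hv (settled_of_eventually_not_bad hstep ?_)
  rcases hp : (Cs N).parent v with _ | p
  · have hnone : ∀ n ≥ N, (Cs n).parent v = none := by
      intro n hn
      induction n, hn using Nat.le_induction with
      | base => exact hp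
      | succ n hn ih => exact (hstep n).parent_eq_none hα ih
    filter_upwards [hpar, eventually_ge_atTop N] with n hn hNn hb
    obtain ⟨q, hq, -⟩ := hn v hb.1 hb.2
    simp [hnone (n + 1) (by omega)] at hq
  · have hsome : ∀ n ≥ N, ∃ u, (Cs n).parent v = some u ∧ Settled Cs As u := by
      intro n hn
      induction n, hn using Nat.le_induction with
      | base => exact ⟨p, hp, ih p hp⟩
      | succ n hn ih => exact hN n hn v hv ih
    filter_upwards [hpar, eventually_ge_atTop N] with n hn hNn hb
    obtain ⟨q, hq, hqs⟩ := hn v hb.1 hb.2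
    obtain ⟨u, hu, hus⟩ := hsome (n + 1) (by omega)
    obtain rfl : u = q := by simpa [hu] using hq
    exact hqs hus

theorem eventually_isLeaf_of_isLeaf (hα : 1 ≤ α)
    (hstep : ∀ n, Step α (Cs n) (Cs (n + 1)) (As n)) :
    ∀ᶠ n in atTop, ∀ v, (Cs n).IsLeaf v → (Cs (n + 1)).IsLeaf v := by
  refine eventually_all.2 fun v => ?_
  rcases eventually_or_eventually_not (P := fun n => ¬ (Cs n).IsLeaf v)
    (Eventually.of_forall fun n hn => (hstep n).not_isLeaf hα hn) with h | h
  · exact h.mono fun n hn hl => absurd hl hn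
  · exact ((tendsto_add_atTop_nat 1).eventually h).mono fun n hn _ => not_not.1 hn

/-- If every node is settled, then eventually the tree does not change. -/
theorem eventually_parent_eq (hα : 1 ≤ α)
    (hstep : ∀ n, Step α (Cs n) (Cs (n + 1)) (As n)) (hset : ∀ v, Settled Cs As v) :
    ∀ v, ∀ᶠ n in atTop, (Cs (n + 1)).parent v = (Cs n).parent v := by
  obtain ⟨N, hN⟩ := eventually_atTop.1 (eventually_not_updated_of_settled Cs As)
  have hH : ∀ n ≥ N, (Cs n).height = (Cs N).height := by
    intro n hn
    induction n, hn using Nat.le_induction with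
    | base => rfl
    | succ n hn ih =>
      rw [← ih]
      exact funext fun v => (hstep n).height_keep v (hN n hn v (hset v))
  obtain ⟨B, hB⟩ := Finite.exists_le (Cs N).height
  intro v
  induction v using (measure fun v => (B - (Cs N).height v).toNat).wf.induction with
  | _ v ih =>
  have hhigh : ∀ᶠ n in atTop, ∀ w, (Cs N).height v < (Cs N).height w →
      (Cs (n + 1)).parent w = (Cs n).parent w := by
    refine eventually_all.2 fun w => ?_
    by_cases hw : (Cs N).height v < (Cs N).height w
    · refine (ih w ?_).mono fun n hn _ => hn
      have := hB w
      change (B - (Cs N).height w).toNat < (B - (Cs N).height v).toNat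
      omega
    · exact Eventually.of_forall fun n h => absurd h hw
  let f : ℕ → ℤ := fun n => -(((Cs n).parent v).elim B (Cs N).height)
  have hmove : ∀ᶠ n in atTop,
      (Cs (n + 1)).parent v = (Cs n).parent v ∨ f (n + 1) < f n := by
    filter_upwards [hhigh, eventually_isLeaf_of_isLeaf hα hstep, eventually_ge_atTop N]
      with n hn hleaf hNn
    rcases (hstep n).parent_cases hα v with h | ⟨x, hxA, hx, rfl, h⟩ | ⟨x, hxA, hx, hl, rfl, h⟩
    · exact Or.inl h
    · exfalso
      have hl : ¬ (Cs n).IsLeaf ((Cs n).maxChild x) := fun hl => not_isLeaf_of_parent h (hleaf _ hl)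
      obtain ⟨h1, h2⟩ := hx.grandchild_spec hl
      have h3 := (hx.spec hα).2.2.2
      rw [hH n hNn] at h2 h3
      have h4 := hn ((Cs n).maxChild ((Cs n).maxChild x)) (by omega)
      rw [(hstep n).swap_in x hxA hx, h1] at h4
      have h5 := (hx.spec hα).2.2.1
      rw [← Option.some.inj h4] at h5
      omega
    · right
      have h5 := (hx.spec hα).2.2.1
      rw [hH n hNn] at h5
      simp only [f, h, (hx.grandchild_spec hl).1, Option.elim_some]
      omega
  have hf := eventually_succ_eq_of_succ_le (f := f) (L := -B)
    (fun n => by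
      simp only [f]
      rcases (Cs n).parent v with _ | p
      · simp
      · simpa using hB p)
    (hmove.mono fun n hn => by
      rcases hn with h | h
      · simp [f, h]
      · exact h.le)
  filter_upwards [hmove, hf] with n hn heq
  exact hn.resolve_right (by omega)

theorem not_forall_step (hα : 1 ≤ α) (hW : WellFounded fun p v => (Cs 0).parent v = some p) :
    ¬ ∀ n, Step α (Cs n) (Cs (n + 1)) (As n) := by
  intro hstep
  have hset := settled_of_wellFounded hα hstep hW
  obtain ⟨n, hn, hpar⟩ := ((eventually_not_updated_of_settled Cs As).and
    (eventually_all.2 (eventually_parent_eq hα hstep hset))).exists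
  obtain ⟨u, huA⟩ := (hstep n).nonempty
  have hu := ((hstep n).all_enabled u huA).resolve_left fun h => hn u (hset u) ⟨huA, h⟩
  obtain ⟨-, h2, h3, -⟩ := hu.spec hα
  have h4 := (hstep n).swap_out u huA hu
  rw [hpar, h2] at h4
  rw [← Option.some.inj h4] at h3
  omega

end Execution

end PreConfig

theorem PreConfig.IsTree.wellFounded_parent {V : Type*} {C : PreConfig V} {r : V} (hT : C.IsTree r) :
    WellFounded fun p v => C.parent v = some p := by
  refine ⟨fun v => ?_⟩
  induction hT.2.2 v using Relation.ReflTransGen.head_induction_on with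
  | refl => exact ⟨r, fun y hy => by simp [hT.1] at hy⟩
  | head h _ ih =>
    refine ⟨_, fun y hy => ?_⟩
    rw [h] at hy
    exact Option.some.inj hy ▸ ih

/-- In any execution starting from an arbitrary initial configuration,
a configuration containing no bad nodes is reached after a finite number of
execution steps. -/
theorem stmt9 {V : Type*} [Fintype V] [LinearOrder V] (α : ℤ) (hα : 1 ≤ α)
    (Cs : ℕ → PreConfig V) (As : ℕ → Finset V) (r : V)
    (hT : (Cs 0).IsTree r)
    (hstep : ∀ n, PreConfig.Step α (Cs n) (Cs (n + 1)) (As n)) :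
    ∃ n, ∀ u, ¬ (Cs n).Bad u := by
  exact absurd hstep (PreConfig.not_forall_step hα hT.wellFounded_parent)
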